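/- If B and R are two C4-free simple graphs on the same finite vertex set V, then ω(G(B,R)) ≤ ω(B) + ω(R) + (1/2)·min(ω(B), ω(R)); equivalently, 2·ω(G(B,R)) ≤ 2·ω(B) + 2·ω(R) + min(ω(B), ω(R)), where ω denotes the clique number. -/

import Mathlib

/-- A graph is `C4`-free: it has no induced cycle on four vertices. -/
def IsC4Free {V : Type*} (G : SimpleGraph V) : Prop :=
  ¬ ∃ a b c d : V, a ≠ c ∧ b ≠ d ∧
    G.Adj a b ∧ G.Adj b c ∧ G.Adj c d ∧ G.Adj d a ∧ ¬ G.Adj a c ∧ ¬ G.Adj b d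

/-- Any two edges of the graph meet or are joined by an edge. -/
def IsTwoK2Free {W : Type*} (G : SimpleGraph W) : Prop :=
  ∀ a b c d : W, G.Adj a b → G.Adj c d → G.Adj a c ∨ G.Adj a d ∨ G.Adj b c ∨ G.Adj b d

/-- The vertex `v` is joined by `P` to both ends of some edge of `Q`. -/
def IsApex {W : Type*} (P Q : SimpleGraph W) (v : W) : Prop :=
  ∃ a b, P.Adj v a ∧ P.Adj v b ∧ Q.Adj a b

/-- `c` is a 5-cycle of `P` whose complementary 5-cycle lies in `Q`. -/
def IsPentagon {W : Type*} (P Q : SimpleGraph W) (c : ZMod 5 → W) : Prop :=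
  ∀ i, P.Adj (c i) (c (i + 1)) ∧ Q.Adj (c i) (c (i + 2))

/-- The vertex `u` is joined to the pentagon `c` in the same way as `c i`. -/
def IsTwin {W : Type*} (P Q : SimpleGraph W) (c : ZMod 5 → W) (i : ZMod 5) (u : W) : Prop :=
  P.Adj u (c (i + 1)) ∧ P.Adj u (c (i + 4)) ∧ Q.Adj u (c (i + 2)) ∧ Q.Adj u (c (i + 3))

section Pentagons

variable {W : Type*} {P Q : SimpleGraph W}

theorem IsC4Free.isTwoK2Free_compl {G : SimpleGraph W} (h : IsC4Free G) :
    IsTwoK2Free Gᶜ := by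
  intro a b c d hab hcd
  by_contra! hcon
  have hne := hab.ne
  have hne' := hcd.ne
  simp only [SimpleGraph.compl_adj] at hab hcd hcon
  have h1 : a ≠ c := by grind [SimpleGraph.adj_comm]
  have h2 : a ≠ d := by grind [SimpleGraph.adj_comm]
  have h3 : b ≠ c := by grind [SimpleGraph.adj_comm]
  have h4 : b ≠ d := by grind [SimpleGraph.adj_comm]
  refine h ⟨a, c, b, d, hne, hne', ?_, ?_, ?_, ?_, hab.2, hcd.2⟩ <;>
    grind [SimpleGraph.adj_comm]

theorem IsApex.of_adj (hPQ : Disjoint P Q) (hQ : IsTwoK2Free Q) {b x : W}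
    (hb : IsApex P Q b) (hbx : Q.Adj b x) : IsApex Q P x := by
  have hd : ∀ a b, P.Adj a b → ¬ Q.Adj a b := fun a b h h' =>
    SimpleGraph.disjoint_left.1 hPQ a b h h'
  obtain ⟨a, w, hba, hbw, haw⟩ := hb
  rcases hQ x b a w hbx.symm haw with h | h | h | h
  · exact ⟨b, a, hbx.symm, h, hba⟩
  · exact ⟨b, w, hbx.symm, h, hbw⟩
  · exact absurd h (hd _ _ hba)
  · exact absurd h (hd _ _ hbw)

/-- A vertex set without apices splits into a `P`-independent and a `Q`-independent set. -/
theorem exists_indep_partition_of_not_isApex (hPQ : Disjoint P Q) (hP : IsTwoK2Free P) (U : Finset W)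
    (hU : ∀ v ∈ U, ¬ IsApex P Q v) :
    ∃ X ⊆ U, ∃ Y ⊆ U, (∀ v ∈ U, v ∈ X ∨ v ∈ Y) ∧
      (∀ x ∈ X, ∀ y ∈ X, ¬ P.Adj x y) ∧ (∀ x ∈ Y, ∀ y ∈ Y, ¬ Q.Adj x y) := by
  classical
  induction U using Finset.strongInduction with
  | H U ih =>
    rcases U.eq_empty_or_nonempty with rfl | ⟨v, hv⟩
    · exact ⟨∅, by simp⟩
    set Y₁ := U.filter fun a => P.Adj v a with hY₁
    set X₁ := U.filter fun w => w = v ∨ ∃ a ∈ Y₁, Q.Adj a w with hX₁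
    have mY : ∀ a, a ∈ Y₁ ↔ a ∈ U ∧ P.Adj v a := by simp [hY₁]
    have mX : ∀ w, w ∈ X₁ ↔ w ∈ U ∧ (w = v ∨ ∃ a ∈ Y₁, Q.Adj a w) := by simp [hX₁]
    have hYi : ∀ x ∈ Y₁, ∀ y ∈ Y₁, ¬ Q.Adj x y := fun x hx y hy h =>
      hU v hv ⟨x, y, ((mY x).1 hx).2, ((mY y).1 hy).2, h⟩
    have hdisj : ∀ x ∈ X₁, x ∉ Y₁ := by
      intro x hx hxY
      obtain ⟨-, rfl | ⟨a, ha, hax⟩⟩ := (mX x).1 hx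
      · exact P.loopless.irrefl _ ((mY x).1 hxY).2
      · exact hYi a ha x hxY hax
    have hN : ∀ w ∈ X₁, ∀ b ∈ U, P.Adj w b → b ∈ Y₁ := by
      intro w hw b hb hwb
      obtain ⟨hwU, rfl | ⟨a, ha, haw⟩⟩ := (mX w).1 hw
      · exact (mY b).2 ⟨hb, hwb⟩
      · rcases hP v a w b ((mY a).1 ha).2 hwb with h | h | h | h
        · exact absurd ((mY w).2 ⟨hwU, h⟩) (hdisj w hw)
        · exact (mY b).2 ⟨hb, h⟩
        · exact (SimpleGraph.disjoint_left.1 hPQ _ _ h haw).elim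
        · exact absurd ⟨a, w, h.symm, hwb.symm, haw⟩ (hU b hb)
    have hlt : U \ (X₁ ∪ Y₁) ⊂ U := by
      refine Finset.ssubset_iff_subset_ne.2 ⟨Finset.sdiff_subset, fun h => ?_⟩
      have : v ∈ U \ (X₁ ∪ Y₁) := by rwa [h]
      exact (Finset.mem_sdiff.1 this).2 (Finset.mem_union_left _ ((mX v).2 ⟨hv, Or.inl rfl⟩))
    obtain ⟨X, hX, Y, hY, hcov, hXi, hYi'⟩ :=
      ih _ hlt fun v hv => hU v (Finset.sdiff_subset hv)
    have hX' : ∀ x ∈ X, x ∈ U ∧ x ∉ X₁ ∧ x ∉ Y₁ := by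
      intro x hx; simpa using hX hx
    have hY' : ∀ x ∈ Y, x ∈ U ∧ x ∉ X₁ ∧ x ∉ Y₁ := by
      intro x hx; simpa using hY hx
    refine ⟨X₁ ∪ X, ?_, Y₁ ∪ Y, ?_, ?_, ?_, ?_⟩
    · intro x hx; grind
    · intro x hx; grind
    · intro x hx; grind
    · intro x hx y hy hxy
      have := hxy.symm
      grind
    · intro x hx y hy hxy
      have := hxy.symm
      grind

theorem IsPentagon.swap {c : ZMod 5 → W} (hc : IsPentagon P Q c) :
    IsPentagon Q P (fun i => c (2 * i)) := by
  intro i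
  constructor
  · have := (hc (2 * i)).2
    rwa [show 2 * i + 2 = 2 * (i + 1) by ring] at this
  · have := (hc (2 * (i + 2))).1
    rw [(by decide : ∀ i : ZMod 5, 2 * (i + 2) + 1 = 2 * i) i] at this
    exact this.symm

theorem exists_isPentagon (hPQ : Disjoint P Q) (hP : IsTwoK2Free P) (hQ : IsTwoK2Free Q)
    {v : W} (hv : IsApex P Q v) (hv' : IsApex Q P v) :
    ∃ c, IsPentagon P Q c ∧ c 0 = v := by
  have hd : ∀ a b, P.Adj a b → ¬ Q.Adj a b := fun a b h h' =>
    SimpleGraph.disjoint_left.1 hPQ a b h h'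
  obtain ⟨a, b, hva, hvb, hab⟩ := hv
  obtain ⟨x, y, hvx, hvy, hxy⟩ := hv'
  have key : ∀ x y, Q.Adj v x → Q.Adj v y → P.Adj x y → P.Adj a x →
      ∃ c, IsPentagon P Q c ∧ c 0 = v := by
    intro x y hvx hvy hxy hax
    have h1 := hQ a b v x hab hvx
    have h2 := hP v b x y hvb hxy
    have h3 := hQ a b v y hab hvy
    have hbx : Q.Adj b x := by grind [SimpleGraph.adj_comm]
    have hby : P.Adj b y := by grind [SimpleGraph.adj_comm]
    have hay : Q.Adj a y := by grind [SimpleGraph.adj_comm]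
    let c : Fin 5 → W := ![v, a, x, y, b]
    refine ⟨c, ?_, rfl⟩
    intro i
    change Fin 5 at i
    fin_cases i
    · exact ⟨hva, hvx⟩
    · exact ⟨hax, hay⟩
    · exact ⟨hxy, hbx.symm⟩
    · exact ⟨hby.symm, hvy.symm⟩
    · exact ⟨hvb.symm, hab.symm⟩
  rcases hP v a x y hva hxy with h | h | h | h
  · exact absurd hvx (hd _ _ h)
  · exact absurd hvy (hd _ _ h)
  · exact key x y hvx hvy hxy h
  · exact key y x hvy hvx hxy.symm h

theorem IsPentagon.exists_isTwin {c : ZMod 5 → W} (hc : IsPentagon P Q c)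
    (hPQ : Disjoint P Q) (hP : IsTwoK2Free P) (hQ : IsTwoK2Free Q) {u : W} {i j : ZMod 5}
    (hi : P.Adj u (c i)) (hj : Q.Adj u (c j)) : ∃ k, IsTwin P Q c k u := by
  have hd : ∀ a b, P.Adj a b → ¬ Q.Adj a b := fun a b h h' =>
    SimpleGraph.disjoint_left.1 hPQ a b h h'
  have hp : ∀ i, P.Adj u (c i) → P.Adj u (c (i + 2)) ∨ P.Adj u (c (i + 3)) := by
    intro i hi
    have h := hP u (c i) _ _ hi (hc (i + 2)).1
    have h1 := (hc i).2
    have h2 := (hc (i + 3)).2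
    rw [(by decide : ∀ i : ZMod 5, i + 3 + 2 = i) i] at h2
    rw [show i + 2 + 1 = i + 3 by ring] at h
    grind [SimpleGraph.adj_comm]
  have hq : ∀ i, Q.Adj u (c i) → Q.Adj u (c (i + 1)) ∨ Q.Adj u (c (i + 4)) := by
    intro i hi
    have h := hQ u (c i) _ _ hi (hc (i + 4)).2
    have h1 := (hc i).1
    have h2 := (hc (i + 4)).1
    rw [(by decide : ∀ i : ZMod 5, i + 4 + 1 = i) i] at h2
    rw [(by decide : ∀ i : ZMod 5, i + 4 + 2 = i + 1) i] at h
    grind [SimpleGraph.adj_comm]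
  have main : ∀ p q : ZMod 5 → Bool, (∀ i, p i → p (i + 2) ∨ p (i + 3)) →
      (∀ i, q i → q (i + 1) ∨ q (i + 4)) → (∀ i, p i → ¬ q i) → (∃ i, p i) → (∃ i, q i) →
      ∃ k, p (k + 1) ∧ p (k + 4) ∧ q (k + 2) ∧ q (k + 3) := by
    decide
  classical
  obtain ⟨k, hk⟩ := main (fun i => decide (P.Adj u (c i))) (fun i => decide (Q.Adj u (c i)))
    (by simpa using hp) (by simpa using hq) (by simpa using fun i => hd u (c i))
    ⟨i, by simpa using hi⟩ ⟨j, by simpa using hj⟩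
  exact ⟨k, by simpa [IsTwin] using hk⟩

/-- A `Q`-neighbour of a vertex without `Q`-neighbours on a pentagon has no `P`-neighbours there. -/
theorem IsPentagon.not_adj_of_adj {c : ZMod 5 → W} (hc : IsPentagon P Q c)
    (hPQ : Disjoint P Q) (hP : IsTwoK2Free P) (hQ : IsTwoK2Free Q) {x y : W}
    (hxy : Q.Adj x y) (hx : ∀ i, ¬ Q.Adj x (c i)) (i : ZMod 5) :
    (∃ j, Q.Adj y (c j)) ∧ ¬ P.Adj y (c i) := by
  have hcov : ∀ j, Q.Adj y (c j) ∨ Q.Adj y (c (j + 2)) := fun j => by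
    have := hQ x y _ _ hxy (hc j).2
    grind
  have hy : ∃ j, Q.Adj y (c j) := by
    rcases hcov 0 with h | h
    exacts [⟨_, h⟩, ⟨_, h⟩]
  refine ⟨hy, fun hi => ?_⟩
  obtain ⟨j, hj⟩ := hy
  obtain ⟨k, h1, h4, -⟩ := hc.exists_isTwin hPQ hP hQ hi hj
  rcases hcov (k + 4) with h | h
  · exact SimpleGraph.disjoint_left.1 hPQ _ _ h4 h
  · rw [(by decide : ∀ k : ZMod 5, k + 4 + 2 = k + 1) k] at h
    exact SimpleGraph.disjoint_left.1 hPQ _ _ h1 h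

theorem IsPentagon.exists_adj {c d : ZMod 5 → W} (hc : IsPentagon P Q c)
    (hd : IsPentagon P Q d) (hPQ : Disjoint P Q) (hP : IsTwoK2Free P) (hQ : IsTwoK2Free Q) :
    ∃ i, Q.Adj (d 0) (c i) := by
  by_contra! h
  have h2 : ∀ i, ¬ P.Adj (d 2) (c i) := fun i =>
    (hc.not_adj_of_adj hPQ hP hQ (hd 0).2 h i).2
  have h3 : ∀ i, ¬ Q.Adj (d 3) (c (2 * i)) := fun i =>
    (hc.swap.not_adj_of_adj hPQ.symm hQ hP (hd 2).1 (fun i => h2 (2 * i)) i).2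
  obtain ⟨j, hj⟩ := (hc.not_adj_of_adj hPQ hP hQ (hd 3).2.symm h 0).1
  apply h3 (3 * j)
  rwa [(by decide : ∀ j : ZMod 5, 2 * (3 * j) = j) j]

theorem IsPentagon.exists_isTwin_of_isApex {c : ZMod 5 → W} (hc : IsPentagon P Q c)
    (hPQ : Disjoint P Q) (hP : IsTwoK2Free P) (hQ : IsTwoK2Free Q) {u : W}
    (hu : IsApex P Q u) (hu' : IsApex Q P u) : ∃ k, IsTwin P Q c k u := by
  obtain ⟨d, hd, rfl⟩ := exists_isPentagon hPQ hP hQ hu hu'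
  obtain ⟨j, hj⟩ := hc.exists_adj hd hPQ hP hQ
  obtain ⟨i, hi⟩ := hc.swap.exists_adj hd.swap hPQ.symm hQ hP
  exact hc.exists_isTwin hPQ hP hQ (by simpa using hi) hj

theorem IsPentagon.not_adj_of_isTwin {c : ZMod 5 → W} (hc : IsPentagon P Q c)
    (hPQ : Disjoint P Q) (hP : IsTwoK2Free P) {i : ZMod 5} {x y : W}
    (hx : IsTwin P Q c i x) (hy : IsTwin P Q c i y) : ¬ P.Adj x y := by
  have hd : ∀ a b, P.Adj a b → ¬ Q.Adj a b := fun a b h h' =>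
    SimpleGraph.disjoint_left.1 hPQ a b h h'
  intro h
  have h2 := hP x y _ _ h (hc (i + 2)).1
  rw [show i + 2 + 1 = i + 3 by ring] at h2
  grind [IsTwin]

theorem IsPentagon.not_adj_of_isTwin_add_two {c : ZMod 5 → W} (hc : IsPentagon P Q c)
    (hPQ : Disjoint P Q) (hQ : IsTwoK2Free Q) {i : ZMod 5} {x y : W}
    (hx : IsTwin P Q c i x) (hy : IsTwin P Q c (i + 2) y) : ¬ P.Adj x y := by
  have hd : ∀ a b, P.Adj a b → ¬ Q.Adj a b := fun a b h h' =>
    SimpleGraph.disjoint_left.1 hPQ a b h h'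
  intro h
  obtain ⟨-, hx4, -, hx3⟩ := hx
  obtain ⟨hy3, -, hy4, -⟩ := hy
  rw [show i + 2 + 1 = i + 3 by ring] at hy3
  rw [show i + 2 + 2 = i + 4 by ring] at hy4
  have h34 := (hc (i + 3)).1
  rw [show i + 3 + 1 = i + 4 by ring] at h34
  have := hQ _ _ _ _ hx3 hy4
  grind [SimpleGraph.adj_comm]

theorem IsTwin.eq {c : ZMod 5 → W} (hPQ : Disjoint P Q) {i j : ZMod 5} {x : W}
    (hi : IsTwin P Q c i x) (hj : IsTwin P Q c j x) : i = j := by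
  have hd : ∀ k, P.Adj x (c k) → ¬ Q.Adj x (c k) := fun k h h' =>
    SimpleGraph.disjoint_left.1 hPQ _ _ h h'
  obtain ⟨h1, h2, h3, h4⟩ := hi
  obtain ⟨g1, g2, g3, g4⟩ := hj
  have key : ∀ i j : ZMod 5, i = j ∨ i + 1 = j + 2 ∨ i + 1 = j + 3 ∨ i + 4 = j + 2 ∨
    i + 4 = j + 3 := by decide
  rcases key i j with h | h | h | h | h
  · exact h
  · exact absurd g3 (hd _ (h ▸ h1))
  · exact absurd g4 (hd _ (h ▸ h1))
  · exact absurd g3 (hd _ (h ▸ h2))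
  · exact absurd g4 (hd _ (h ▸ h2))

theorem five_mul_card_add_two_mul_card_le (hPQ : Disjoint P Q) (hP : IsTwoK2Free P)
    (hQ : IsTwoK2Free Q) {n : ℕ}
    (hn : ∀ s : Finset W, (∀ x ∈ s, ∀ y ∈ s, ¬ P.Adj x y) → s.card ≤ n)
    {C X : Finset W} (hC : ∀ v ∈ C, IsApex P Q v ∧ IsApex Q P v)
    (hX : ∀ x ∈ X, ∀ y ∈ X, ¬ P.Adj x y) (hXC : ∀ x ∈ X, ∀ y ∈ C, ¬ P.Adj x y)
    (hd : Disjoint X C) : 5 * X.card + 2 * C.card ≤ 5 * n := by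
  classical
  rcases C.eq_empty_or_nonempty with rfl | ⟨v, hv⟩
  · simpa using hn X hX
  obtain ⟨c, hc, -⟩ := exists_isPentagon hPQ hP hQ (hC v hv).1 (hC v hv).2
  set A : ZMod 5 → Finset W := fun i => C.filter fun u => IsTwin P Q c i u with hA
  have mA : ∀ i u, u ∈ A i ↔ u ∈ C ∧ IsTwin P Q c i u := by simp [hA]
  have hcard : C.card ≤ ∑ i, (A i).card := by
    refine le_trans (Finset.card_le_card fun u hu => ?_) Finset.card_biUnion_le
    obtain ⟨k, hk⟩ := hc.exists_isTwin_of_isApex hPQ hP hQ (hC u hu).1 (hC u hu).2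
    exact Finset.mem_biUnion.2 ⟨k, Finset.mem_univ _, (mA k u).2 ⟨hu, hk⟩⟩
  have hbound : ∀ i, X.card + ((A i).card + (A (i + 2)).card) ≤ n := by
    intro i
    have hAA : Disjoint (A i) (A (i + 2)) := by
      refine Finset.disjoint_left.2 fun u hu hu' => ?_
      exact (by decide : ∀ i : ZMod 5, i ≠ i + 2) i (((mA _ _).1 hu).2.eq hPQ ((mA _ _).1 hu').2)
    have hXA : Disjoint X (A i ∪ A (i + 2)) :=
      hd.mono_right (Finset.union_subset (Finset.filter_subset _ _) (Finset.filter_subset _ _))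
    rw [← Finset.card_union_of_disjoint hAA, ← Finset.card_union_of_disjoint hXA]
    refine hn _ fun x hx y hy hxy => ?_
    have hs := hxy.symm
    have t1 := @IsPentagon.not_adj_of_isTwin _ _ _ _ hc hPQ hP
    have t2 := @IsPentagon.not_adj_of_isTwin_add_two _ _ _ _ hc hPQ hQ
    simp only [Finset.mem_union, mA] at hx hy
    rcases hx with hx | hx | hx <;> rcases hy with hy | hy | hy
    · exact hX x hx y hy hxy
    · exact hXC x hx y hy.1 hxy
    · exact hXC x hx y hy.1 hxy
    · exact hXC y hy x hx.1 hs
    · exact t1 hx.2 hy.2 hxy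
    · exact t2 hx.2 hy.2 hxy
    · exact hXC y hy x hx.1 hs
    · exact t2 hy.2 hx.2 hs
    · exact t1 hx.2 hy.2 hxy
  have hsum := Finset.sum_le_sum fun i (_ : i ∈ Finset.univ) => hbound i
  have hshift : ∑ i, (A (i + 2)).card = ∑ i, (A i).card :=
    Equiv.sum_comp (Equiv.addRight (2 : ZMod 5)) fun i => (A i).card
  simp only [Finset.sum_add_distrib, hshift, Finset.sum_const, Finset.card_univ, ZMod.card,
    smul_eq_mul] at hsum
  lia

theorem two_mul_card_le [Fintype W] (hPQ : Disjoint P Q) (hP : IsTwoK2Free P)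
    (hQ : IsTwoK2Free Q) {m n : ℕ}
    (hm : ∀ s : Finset W, (∀ x ∈ s, ∀ y ∈ s, ¬ P.Adj x y) → s.card ≤ m)
    (hn : ∀ s : Finset W, (∀ x ∈ s, ∀ y ∈ s, ¬ Q.Adj x y) → s.card ≤ n) :
    2 * Fintype.card W ≤ 2 * m + 2 * n + min m n := by
  classical
  obtain ⟨X, hXU, Y, hYU, hcov, hX, hY⟩ := exists_indep_partition_of_not_isApex hPQ hP
    (Finset.univ.filter fun v => ¬ IsApex P Q v ∧ ¬ IsApex Q P v)
    fun v hv => (Finset.mem_filter.1 hv).2.1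
  have hXU' : ∀ x ∈ X, ¬ IsApex P Q x ∧ ¬ IsApex Q P x := fun x hx => by simpa using hXU hx
  have hYU' : ∀ x ∈ Y, ¬ IsApex P Q x ∧ ¬ IsApex Q P x := fun x hx => by simpa using hYU hx
  have hcov' : ∀ v, ¬ IsApex P Q v → ¬ IsApex Q P v → v ∈ X ∨ v ∈ Y := fun v h h' =>
    hcov v (by simp [h, h'])
  have eP : ∀ x y, IsApex Q P x → P.Adj x y → IsApex P Q y := fun x y hx hxy =>
    hx.of_adj hPQ.symm hP hxy
  have eQ : ∀ x y, IsApex P Q x → Q.Adj x y → IsApex Q P y := fun x y hx hxy =>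
    hx.of_adj hPQ hQ hxy
  set C := Finset.univ.filter fun v => IsApex P Q v ∧ IsApex Q P v with hC
  set S := Finset.univ.filter fun v => ¬ IsApex P Q v ∧ IsApex Q P v with hS
  set T := Finset.univ.filter fun v => IsApex P Q v ∧ ¬ IsApex Q P v with hT
  have mC : ∀ v, v ∈ C ↔ IsApex P Q v ∧ IsApex Q P v := by simp [hC]
  have mS : ∀ v, v ∈ S ↔ ¬ IsApex P Q v ∧ IsApex Q P v := by simp [hS]
  have mT : ∀ v, v ∈ T ↔ IsApex P Q v ∧ ¬ IsApex Q P v := by simp [hT]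
  have h1 := five_mul_card_add_two_mul_card_le hPQ hP hQ hm (C := C) (X := S ∪ X)
    (fun v hv => (mC v).1 hv)
    (by intro x hx y hy hxy; have := hxy.symm; grind)
    (by intro x hx y hy hxy; have := hxy.symm; grind)
    (by rw [Finset.disjoint_left]; grind)
  have h2 := five_mul_card_add_two_mul_card_le hPQ.symm hQ hP hn (C := C) (X := T ∪ Y)
    (fun v hv => ((mC v).1 hv).symm)
    (by intro x hx y hy hxy; have := hxy.symm; grind)
    (by intro x hx y hy hxy; have := hxy.symm; grind)
    (by rw [Finset.disjoint_left]; grind)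
  have h3 : Fintype.card W ≤ (S ∪ X).card + (T ∪ Y).card + C.card := by
    rw [← Finset.card_univ]
    calc _ ≤ ((S ∪ X) ∪ (T ∪ Y) ∪ C).card := Finset.card_le_card fun v _ => by grind
      _ ≤ _ := (Finset.card_union_le _ _).trans (by gcongr; exact Finset.card_union_le _ _)
  rcases min_choice m n with h | h <;> lia

end Pentagons

theorem stmt_10 {V : Type*} [Fintype V] (B R : SimpleGraph V)
    (hB4 : IsC4Free B) (hR4 : IsC4Free R) :
    2 * (B ⊔ R).cliqueNum ≤
      2 * B.cliqueNum + 2 * R.cliqueNum + min B.cliqueNum R.cliqueNum := by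
  classical
  obtain ⟨K, hK⟩ := (B ⊔ R).exists_isNClique_cliqueNum
  have hfree : ∀ G : SimpleGraph V, IsC4Free G → IsTwoK2Free (G.induce (K : Set V))ᶜ :=
    fun G hG => IsC4Free.isTwoK2Free_compl fun ⟨a, b, c, d, hac, hbd, h⟩ =>
      hG ⟨a, b, c, d, Subtype.coe_ne_coe.2 hac, Subtype.coe_ne_coe.2 hbd, h⟩
  have hbound : ∀ G : SimpleGraph V, ∀ s : Finset (K : Set V),
      (∀ x ∈ s, ∀ y ∈ s, ¬ (G.induce (K : Set V))ᶜ.Adj x y) → s.card ≤ G.cliqueNum := by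
    intro G s hs
    rw [← Finset.card_map (Function.Embedding.subtype _)]
    refine SimpleGraph.IsClique.card_le_cliqueNum (tc := ?_)
    intro x hx y hy hxy
    simp only [Finset.coe_map, Set.mem_image, Finset.mem_coe] at hx hy
    obtain ⟨x, hx, rfl⟩ := hx
    obtain ⟨y, hy, rfl⟩ := hy
    have := hs x hx y hy
    rw [SimpleGraph.compl_adj] at this
    by_contra hcon
    exact this ⟨fun h => hxy (h ▸ rfl), hcon⟩
  have hdisj : Disjoint (B.induce (K : Set V))ᶜ (R.induce (K : Set V))ᶜ := by
    rw [SimpleGraph.disjoint_left]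
    intro x y hx hy
    rw [SimpleGraph.compl_adj] at hx hy
    rcases hK.isClique x.2 y.2 (Subtype.coe_ne_coe.2 hx.1) with h | h
    exacts [hx.2 h, hy.2 h]
  have := two_mul_card_le hdisj (hfree B hB4) (hfree R hR4) (hbound B) (hbound R)
  rwa [show Fintype.card (K : Set V) = (B ⊔ R).cliqueNum by simpa using hK.card_eq] at this
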